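/- arXiv:math/9904023 — 2 statements merged into one kernel-verified Lean document; each statement's English description precedes it below -/
import Mathlib

section
/- The difference Ramsey number D(4, 4) equals 18: for every B ⊆ {1, …, 17} the difference coloring of the complete graph on {1, …, 18} contains a blue K_4 or a red K_4, and there exists B ⊆ {1, …, 16} such that the difference coloring of the complete graph on {1, …, 17} contains neither a blue K_4 nor a red K_4. -/
/-- A blue `m`-clique of the difference coloring of `K_n` determined by `B`: a set of `m`
vertices in `{1, …, n}` all of whose pairwise differences lie in `B`. -/
def HasBlueClique (B : Set ℕ) (n m : ℕ) : Prop :=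
  ∃ V : Finset ℕ, (∀ v ∈ V, 1 ≤ v ∧ v ≤ n) ∧ V.card = m ∧
    ∀ i ∈ V, ∀ j ∈ V, i < j → j - i ∈ B

/-- A red `m`-clique of the difference coloring of `K_n` determined by `B`: a set of `m`
vertices in `{1, …, n}` none of whose pairwise differences lie in `B`. -/
def HasRedClique (B : Set ℕ) (n m : ℕ) : Prop :=
  ∃ V : Finset ℕ, (∀ v ∈ V, 1 ≤ v ∧ v ≤ n) ∧ V.card = m ∧
    ∀ i ∈ V, ∀ j ∈ V, i < j → j - i ∉ B

/-- The difference Ramsey number `D(k, l)`: the least `N` such that for every set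
`B ⊆ {1, …, N-1}` of blue differences, the difference coloring of `K_N` contains a blue
`K_k` or a red `K_l`. -/
noncomputable def diffRamseyNumber (k l : ℕ) : ℕ :=
  sInf {N | ∀ B : Set ℕ, B ⊆ Set.Icc 1 (N - 1) →
    HasBlueClique B N k ∨ HasRedClique B N l}

/-- Do the gaps `x, y, z` span a monochromatic `K_4` for the mask `b`? -/
def monoGap (b x y z : ℕ) : Bool :=
  (b.testBit x && (b.testBit y && (b.testBit z && (b.testBit (x + y) &&
    (b.testBit (y + z) && b.testBit (x + y + z)))))) ||
  (!b.testBit x && (!b.testBit y && (!b.testBit z && (!b.testBit (x + y) &&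
    (!b.testBit (y + z) && !b.testBit (x + y + z))))))

/-- Is there a monochromatic `K_4` of span exactly `d`? -/
def badSpan (d b : ℕ) : Bool :=
  (List.range d).any fun x => (List.range (d - x)).any fun y =>
    Nat.ble 1 x && (Nat.ble 1 y && monoGap b x y (d - x - y))

/-- Backtracking search: bits below `d` are decided, `k` further bits are to be decided. -/
def refute : ℕ → ℕ → ℕ → Bool
  | 0, _, _ => false
  | k + 1, d, b =>
    (badSpan d b || refute k (d + 1) b) &&
    (badSpan d (b + 2 ^ d) || refute k (d + 1) (b + 2 ^ d))

theorem refute_true : refute 17 1 0 = true := by decide +kernel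

def MonoP (B : Set ℕ) (x y z : ℕ) : Prop :=
  (x ∈ B ∧ y ∈ B ∧ z ∈ B ∧ x + y ∈ B ∧ y + z ∈ B ∧ x + y + z ∈ B) ∨
  (x ∉ B ∧ y ∉ B ∧ z ∉ B ∧ x + y ∉ B ∧ y + z ∉ B ∧ x + y + z ∉ B)

theorem badSpan_sound (B : Set ℕ) (d b : ℕ)
    (h : ∀ i, 1 ≤ i → i ≤ d → (b.testBit i = true ↔ i ∈ B)) (hb : badSpan d b = true) :
    ∃ x y z, 1 ≤ x ∧ 1 ≤ y ∧ 1 ≤ z ∧ x + y + z = d ∧ MonoP B x y z := by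
  simp only [badSpan, List.any_eq_true, List.mem_range, Bool.and_eq_true, Nat.ble_eq] at hb
  obtain ⟨x, hx, y, hy, hx1, hy1, hm⟩ := hb
  refine ⟨x, y, d - x - y, hx1, hy1, by omega, by omega, ?_⟩
  have h1 := h x (by omega) (by omega)
  have h2 := h y (by omega) (by omega)
  have h3 := h (d - x - y) (by omega) (by omega)
  have h4 := h (x + y) (by omega) (by omega)
  have h5 := h (y + (d - x - y)) (by omega) (by omega)
  have h6 := h (x + y + (d - x - y)) (by omega) (by omega)
  simp only [monoGap, Bool.or_eq_true, Bool.and_eq_true, Bool.not_eq_true',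
    ← Bool.not_eq_true] at hm
  rw [h1, h2, h3, h4, h5, h6] at hm
  exact hm

theorem refute_sound (B : Set ℕ) (k : ℕ) : ∀ d b : ℕ, b < 2 ^ d →
    (∀ i, 1 ≤ i → i < d → (b.testBit i = true ↔ i ∈ B)) → refute k d b = true →
    ∃ x y z, 1 ≤ x ∧ 1 ≤ y ∧ 1 ≤ z ∧ x + y + z < d + k ∧ MonoP B x y z := by
  induction k with
  | zero => intro d b _ _ h; simp [refute] at h
  | succ k ih =>
    intro d b hlt h hr
    simp only [refute, Bool.and_eq_true, Bool.or_eq_true] at hr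
    have key : ∀ c, c < 2 ^ (d + 1) →
        (∀ i, 1 ≤ i → i < d + 1 → (c.testBit i = true ↔ i ∈ B)) →
        (badSpan d c = true ∨ refute k (d + 1) c = true) →
        ∃ x y z, 1 ≤ x ∧ 1 ≤ y ∧ 1 ≤ z ∧ x + y + z < d + (k + 1) ∧ MonoP B x y z := by
      intro c hc hcB hor
      rcases hor with hor | hor
      · obtain ⟨x, y, z, hx, hy, hz, hs, hm⟩ :=
          badSpan_sound B d c (fun i h1 h2 => hcB i h1 (by omega)) hor
        exact ⟨x, y, z, hx, hy, hz, by omega, hm⟩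
      · obtain ⟨x, y, z, hx, hy, hz, hs, hm⟩ := ih (d + 1) c hc hcB hor
        exact ⟨x, y, z, hx, hy, hz, by omega, hm⟩
    have hp : 2 ^ (d + 1) = 2 ^ d + 2 ^ d := by ring
    by_cases hd : d ∈ B
    · refine key (b + 2 ^ d) (by omega) ?_ hr.2
      intro i h1 h2
      rcases Nat.lt_succ_iff_lt_or_eq.mp h2 with h3 | rfl
      · rw [← h i h1 h3, Nat.add_comm, Nat.testBit_two_pow_add_gt h3]
      · rw [Nat.add_comm, Nat.testBit_two_pow_add_eq, Nat.testBit_lt_two_pow hlt]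
        simpa using hd
    · refine key b (by omega) ?_ hr.1
      intro i h1 h2
      rcases Nat.lt_succ_iff_lt_or_eq.mp h2 with h3 | rfl
      · exact h i h1 h3
      · rw [Nat.testBit_lt_two_pow hlt]
        simpa using hd

theorem upper_bound (B : Set ℕ) : HasBlueClique B 18 4 ∨ HasRedClique B 18 4 := by
  obtain ⟨x, y, z, hx, hy, hz, hs, hm⟩ := refute_sound B 17 1 0 (by norm_num)
    (fun i h1 h2 => by omega) refute_true
  have hcard : ({1, 1 + x, 1 + x + y, 1 + x + y + z} : Finset ℕ).card = 4 := by
    rw [Finset.card_insert_of_notMem, Finset.card_insert_of_notMem,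
      Finset.card_insert_of_notMem, Finset.card_singleton]
    all_goals
      simp only [Finset.mem_insert, Finset.mem_singleton]
      omega
  have hmem : ∀ v ∈ ({1, 1 + x, 1 + x + y, 1 + x + y + z} : Finset ℕ), 1 ≤ v ∧ v ≤ 18 := by
    intro v hv
    simp only [Finset.mem_insert, Finset.mem_singleton] at hv
    omega
  have hdiff : ∀ i ∈ ({1, 1 + x, 1 + x + y, 1 + x + y + z} : Finset ℕ),
      ∀ j ∈ ({1, 1 + x, 1 + x + y, 1 + x + y + z} : Finset ℕ), i < j →
      j - i = x ∨ j - i = y ∨ j - i = z ∨ j - i = x + y ∨ j - i = y + z ∨ j - i = x + y + z := by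
    intro i hi j hj hij
    simp only [Finset.mem_insert, Finset.mem_singleton] at hi hj
    omega
  rcases hm with ⟨h1, h2, h3, h4, h5, h6⟩ | ⟨h1, h2, h3, h4, h5, h6⟩
  · refine Or.inl ⟨_, hmem, hcard, fun i hi j hj hij => ?_⟩
    rcases hdiff i hi j hj hij with h | h | h | h | h | h <;> rw [h] <;> assumption
  · refine Or.inr ⟨_, hmem, hcard, fun i hi j hj hij => ?_⟩
    rcases hdiff i hi j hj hij with h | h | h | h | h | h <;> rw [h] <;> assumption

/-- The quadratic residues modulo 17. -/
def paley : Finset ℕ := {1, 2, 4, 8, 9, 13, 15, 16}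

/-- The gaps `x, y, z` do not span a monochromatic `K_4`. -/
def paleyGood (x y z : ℕ) : Bool :=
  decide (1 ≤ x ∧ 1 ≤ y ∧ 1 ≤ z ∧ x + y + z < 17 →
    ¬ (x ∈ paley ∧ y ∈ paley ∧ z ∈ paley ∧ x + y ∈ paley ∧ y + z ∈ paley ∧ x + y + z ∈ paley) ∧
    ¬ (x ∉ paley ∧ y ∉ paley ∧ z ∉ paley ∧ x + y ∉ paley ∧ y + z ∉ paley ∧ x + y + z ∉ paley))

theorem paley_all : ∀ x y z : Fin 17, paleyGood x y z = true := by
  decide +kernel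

theorem paley_check (x : ℕ) (h1 : x < 17) (y : ℕ) (h2 : y < 17) (z : ℕ) (h3 : z < 17)
    (hx : 1 ≤ x) (hy : 1 ≤ y) (hz : 1 ≤ z) (h : x + y + z < 17) :
    ¬ (x ∈ paley ∧ y ∈ paley ∧ z ∈ paley ∧ x + y ∈ paley ∧ y + z ∈ paley ∧ x + y + z ∈ paley) ∧
    ¬ (x ∉ paley ∧ y ∉ paley ∧ z ∉ paley ∧ x + y ∉ paley ∧ y + z ∉ paley ∧ x + y + z ∉ paley) :=
  of_decide_eq_true (paley_all ⟨x, h1⟩ ⟨y, h2⟩ ⟨z, h3⟩) ⟨hx, hy, hz, h⟩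

/-- A four-element set of vertices yields its three consecutive gaps. -/
theorem gaps_of_card (P : ℕ → Prop) (n : ℕ) (V : Finset ℕ) (hV : ∀ v ∈ V, 1 ≤ v ∧ v ≤ n)
    (hc : V.card = 4) (h : ∀ i ∈ V, ∀ j ∈ V, i < j → P (j - i)) :
    ∃ x y z, 1 ≤ x ∧ 1 ≤ y ∧ 1 ≤ z ∧ x + y + z < n ∧
      P x ∧ P y ∧ P z ∧ P (x + y) ∧ P (y + z) ∧ P (x + y + z) := by
  let e := V.orderEmbOfFin hc
  have hm : ∀ i, e i ∈ V := fun i => V.orderEmbOfFin_mem hc i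
  have h01 : e 0 < e 1 := e.strictMono (by decide)
  have h12 : e 1 < e 2 := e.strictMono (by decide)
  have h23 : e 2 < e 3 := e.strictMono (by decide)
  have b0 := hV _ (hm 0)
  have b3 := hV _ (hm 3)
  have p1 := h _ (hm 0) _ (hm 1) h01
  have p2 := h _ (hm 1) _ (hm 2) h12
  have p3 := h _ (hm 2) _ (hm 3) h23
  have p4 := h _ (hm 0) _ (hm 2) (h01.trans h12)
  have p5 := h _ (hm 1) _ (hm 3) (h12.trans h23)
  have p6 := h _ (hm 0) _ (hm 3) (h01.trans (h12.trans h23))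
  refine ⟨e 1 - e 0, e 2 - e 1, e 3 - e 2, by omega, by omega, by omega, by omega,
    p1, p2, p3, ?_, ?_, ?_⟩
  · convert p4 using 1; omega
  · convert p5 using 1; omega
  · convert p6 using 1; omega

theorem lower_bound (N : ℕ) (hN : N ≤ 17) :
    ¬ HasBlueClique ((paley : Set ℕ) ∩ Set.Icc 1 (N - 1)) N 4 ∧
    ¬ HasRedClique ((paley : Set ℕ) ∩ Set.Icc 1 (N - 1)) N 4 := by
  constructor
  · rintro ⟨V, hV, hc, h⟩
    obtain ⟨x, y, z, hx, hy, hz, hs, hp⟩ := gaps_of_card (· ∈ paley) N V hV hc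
      (fun i hi j hj hij => by simpa using (h i hi j hj hij).1)
    exact (paley_check x (by omega) y (by omega) z (by omega) hx hy hz (by omega)).1 hp
  · rintro ⟨V, hV, hc, h⟩
    obtain ⟨x, y, z, hx, hy, hz, hs, hp⟩ := gaps_of_card (· ∉ paley) N V hV hc
      (fun i hi j hj hij hmem => h i hi j hj hij ⟨by simpa using hmem, by
        have := hV i hi
        have := hV j hj
        simp only [Set.mem_Icc]
        omega⟩)
    exact (paley_check x (by omega) y (by omega) z (by omega) hx hy hz (by omega)).2 hp

/-- The difference Ramsey number `D(4, 4)` equals `18`: for every `B ⊆ {1, …, 17}` the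
difference coloring of `K_18` contains a blue `K_4` or a red `K_4`, and there is a
`B ⊆ {1, …, 16}` whose difference coloring of `K_17` contains neither. -/
theorem diffRamsey_4_4 :
    diffRamseyNumber 4 4 = 18 ∧
    (∀ B : Set ℕ, B ⊆ Set.Icc 1 17 → HasBlueClique B 18 4 ∨ HasRedClique B 18 4) ∧
    (∃ B : Set ℕ, B ⊆ Set.Icc 1 16 ∧ ¬ HasBlueClique B 17 4 ∧ ¬ HasRedClique B 17 4) := by
  refine ⟨?_, fun B _ => upper_bound B,
    ⟨(paley : Set ℕ) ∩ Set.Icc 1 (17 - 1), Set.inter_subset_right, lower_bound 17 le_rfl⟩⟩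
  apply IsLeast.csInf_eq
  refine ⟨fun B _ => upper_bound B, fun N hN => ?_⟩
  by_contra hlt
  have hl := lower_bound N (by omega)
  rcases hN _ Set.inter_subset_right with h | h
  · exact hl.1 h
  · exact hl.2 h
end

section
/- The classical Ramsey number satisfies R(3, 3, 6) ≥ 60. Specifically, color the edges of the complete graph on vertex set ℤ/59ℤ as follows: for an edge {x, y}, let d be the unique representative of ±(x − y) lying in {1, …, 29}; give the edge color 1 if d ∈ {5, 12, 13, 14, 16, 20, 22}, color 2 if d ∈ {10, 15, 19, 24, 26, 27}, and color 3 otherwise. This 3-coloring of the edges of K_59 contains no triangle in color 1, no triangle in color 2, and no K_6 in color 3. -/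
/-- A monochromatic `m`-clique in color `t` for an edge coloring `c` of the complete
graph on `Fin N`. -/
def HasMonoCliqueOn (N : ℕ) (c : Fin N → Fin N → Fin 3) (t : Fin 3) (m : ℕ) : Prop :=
  ∃ V : Finset (Fin N), V.card = m ∧ ∀ i ∈ V, ∀ j ∈ V, i ≠ j → c i j = t

/-- The classical 3-color Ramsey number `R(k₁, k₂, k₃)`: the least `N` such that every
(symmetric) 3-coloring of the edges of the complete graph on `N` vertices contains, for
some `i`, a complete subgraph on `kᵢ` vertices all of whose edges have color `i`. -/
noncomputable def ramseyNumber3 (k₁ k₂ k₃ : ℕ) : ℕ :=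
  sInf {N | ∀ c : Fin N → Fin N → Fin 3, (∀ i j, c i j = c j i) →
    HasMonoCliqueOn N c 0 k₁ ∨ HasMonoCliqueOn N c 1 k₂ ∨ HasMonoCliqueOn N c 2 k₃}

/-- The cyclic coloring of the edges of `K_59` on vertex set `ℤ/59ℤ`: for an edge
`{x, y}`, let `d = min ((x-y).val) ((y-x).val)` be the unique representative of
`±(x - y)` in `{1, …, 29}`; the edge gets color `0` if `d ∈ {5,12,13,14,16,20,22}`,
color `1` if `d ∈ {10,15,19,24,26,27}`, and color `2` otherwise. -/
def cyclicColor (x y : ZMod 59) : Fin 3 :=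
  if min (x - y).val (y - x).val ∈ ({5, 12, 13, 14, 16, 20, 22} : Finset ℕ) then 0
  else if min (x - y).val (y - x).val ∈ ({10, 15, 19, 24, 26, 27} : Finset ℕ) then 1
  else 2

/-- Bitmask of the differences (both signs, mod 59) of each color. -/
def colorMask (t : Fin 3) : ℕ := if t = 0 then 18270172407230496 else if t = 1 then 581689114395648 else 557608890781797342

/-- Adjacency on natural number labels. -/
def maskAdj (m x y : ℕ) : Bool := Nat.testBit m ((x - y) + (y - x))

/-- Run `f` on the later neighbours of each list element. -/
def stepSearch (m : ℕ) (f : List ℕ → Bool) : List ℕ → Bool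
  | [] => true
  | x :: xs => f (xs.filter (fun y => maskAdj m x y)) && stepSearch m f xs

/-- Exhaustive search certifying that there is no `k`-clique among the list. -/
def noClique (m : ℕ) : ℕ → List ℕ → Bool
  | 0 => fun _ => false
  | k + 1 => stepSearch m (noClique m k)

theorem noClique_sound (m : ℕ) : ∀ (k : ℕ) (l : List ℕ), noClique m k l = true →
    ∀ S : Finset ℕ, (∀ x ∈ S, x ∈ l) → (∀ x ∈ S, ∀ y ∈ S, x ≠ y → maskAdj m x y = true) →
    S.card ≠ k := by
  intro k
  induction k with
  | zero => intro l h; simp [noClique] at h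
  | succ k ih =>
    intro l
    induction l with
    | nil =>
      intro _ S hS _ hc
      have : S = ∅ := Finset.eq_empty_of_forall_notMem (fun x hx => by simpa using hS x hx)
      simp [this] at hc
    | cons a l ihl =>
      intro h S hS hadj hc
      simp only [noClique, stepSearch, Bool.and_eq_true] at h
      by_cases ha : a ∈ S
      · refine ih _ h.1 (S.erase a) ?_ ?_ ?_
        · intro x hx
          obtain ⟨hxa, hxS⟩ := Finset.mem_erase.1 hx
          have h1 := hS x hxS
          simp only [List.mem_cons, hxa, false_or] at h1
          exact List.mem_filter.2 ⟨h1, hadj a ha x hxS (Ne.symm hxa)⟩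
        · intro x hx y hy
          exact hadj x (Finset.mem_of_mem_erase hx) y (Finset.mem_of_mem_erase hy)
        · rw [Finset.card_erase_of_mem ha, hc]; rfl
      · refine ihl h.2 S ?_ hadj hc
        intro x hx
        have h1 := hS x hx
        have hxa : x ≠ a := fun e => ha (e ▸ hx)
        simpa [hxa] using h1

theorem cyclicColor_mask : ∀ x y : ZMod 59, x ≠ y →
    maskAdj (colorMask (cyclicColor x y)) x.val y.val = true := by
  decide +kernel

theorem cyclicColor_sub (x y v : ZMod 59) :
    cyclicColor (x - v) (y - v) = cyclicColor x y := by
  simp [cyclicColor]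

theorem cyclicColor_symm (x y : ZMod 59) : cyclicColor x y = cyclicColor y x := by
  unfold cyclicColor
  rw [min_comm]

theorem no_mono (t : Fin 3) (k : ℕ)
    (h : noClique (colorMask t) k
      ((List.range 59).filter (fun y => maskAdj (colorMask t) 0 y)) = true) :
    ¬ ∃ V : Finset (ZMod 59), V.card = k + 1 ∧
        ∀ i ∈ V, ∀ j ∈ V, i ≠ j → cyclicColor i j = t := by
  rintro ⟨V, hc, hV⟩
  obtain ⟨v, hv⟩ : V.Nonempty := Finset.card_pos.1 (by omega)
  have key : ∀ x ∈ V, ∀ y ∈ V, x ≠ y →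
      maskAdj (colorMask t) (x - v).val (y - v).val = true := by
    intro x hx y hy hxy
    have h1 := cyclicColor_mask (x - v) (y - v) (fun e => hxy (sub_left_injective e))
    rwa [cyclicColor_sub, hV x hx y hy hxy] at h1
  refine noClique_sound _ _ _ h ((V.erase v).image (fun x => (x - v).val)) ?_ ?_ ?_
  · intro n hn
    obtain ⟨x, hx, rfl⟩ := Finset.mem_image.1 hn
    obtain ⟨hxv, hxV⟩ := Finset.mem_erase.1 hx
    refine List.mem_filter.2 ⟨List.mem_range.2 (ZMod.val_lt _), ?_⟩
    simpa using key v hv x hxV (Ne.symm hxv)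
  · intro n hn p hp hnp
    obtain ⟨x, hx, rfl⟩ := Finset.mem_image.1 hn
    obtain ⟨y, hy, rfl⟩ := Finset.mem_image.1 hp
    exact key x (Finset.mem_of_mem_erase hx) y (Finset.mem_of_mem_erase hy)
      (fun e => hnp (by rw [e]))
  · rw [Finset.card_image_of_injective, Finset.card_erase_of_mem hv, hc]
    · rfl
    · exact (ZMod.val_injective 59).comp sub_left_injective

/-- Finite Ramsey theorem for three colors. -/
theorem ramsey_exists : ∀ (n : ℕ) (k : Fin 3 → ℕ), ∑ i, k i = n →
    ∃ N : ℕ, ∀ (M : ℕ) (c : Fin M → Fin M → Fin 3), (∀ i j, c i j = c j i) →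
      ∀ W : Finset (Fin M), N ≤ W.card →
        ∃ t : Fin 3, ∃ V ⊆ W, V.card = k t ∧ ∀ i ∈ V, ∀ j ∈ V, i ≠ j → c i j = t := by
  intro n
  induction n with
  | zero =>
    intro k hk
    refine ⟨0, fun M c _ W _ => ⟨0, ∅, by simp, ?_, by simp⟩⟩
    have := (Finset.sum_eq_zero_iff.1 hk) 0 (Finset.mem_univ _)
    simp [this]
  | succ n ih =>
    intro k hk
    by_cases h0 : ∃ t, k t = 0
    · obtain ⟨t, ht⟩ := h0
      exact ⟨0, fun M c _ W _ => ⟨t, ∅, by simp, by simp [ht], by simp⟩⟩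
    · push Not at h0
      have hstep : ∀ t : Fin 3, ∑ i, Function.update k t (k t - 1) i = n := by
        intro t
        have h1 := h0 0
        have h2 := h0 1
        have h3 := h0 2
        rw [Fin.sum_univ_three] at hk ⊢
        fin_cases t <;> simp [Function.update] <;> omega
      choose N hN using fun t => ih _ (hstep t)
      refine ⟨1 + ∑ t, N t, ?_⟩
      intro M c hsym W hW
      obtain ⟨v, hv⟩ : W.Nonempty := Finset.card_pos.1 (by omega)
      have hpig : ∃ t, N t ≤ ((W.erase v).filter (fun x => c v x = t)).card := by
        by_contra! hlt
        have h1 := Finset.card_eq_sum_card_fiberwise (s := W.erase v) (t := Finset.univ)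
          (f := fun x => c v x) (fun x _ => by simp)
        have h2 := Finset.sum_le_sum (s := Finset.univ) (fun t _ => (hlt t).le)
        rw [Finset.card_erase_of_mem hv] at h1
        have h3 : ∑ t, ((W.erase v).filter (fun x => c v x = t)).card < ∑ t, N t :=
          Finset.sum_lt_sum_of_nonempty Finset.univ_nonempty (fun t _ => hlt t)
        omega
      obtain ⟨t, ht⟩ := hpig
      obtain ⟨s, V, hVW, hVc, hV⟩ := hN t M c hsym _ ht
      have hsub : V ⊆ W := fun x hx =>
        Finset.mem_of_mem_erase (Finset.mem_filter.1 (hVW hx)).1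
      by_cases hst : s = t
      · subst hst
        have hvV : v ∉ V := fun hx => by
          have := (Finset.mem_filter.1 (hVW hx)).1
          simp at this
        refine ⟨s, insert v V, Finset.insert_subset hv hsub, ?_, ?_⟩
        · rw [Finset.card_insert_of_notMem hvV, hVc]
          have := h0 s
          simp
          omega
        · have hcol : ∀ x ∈ V, c v x = s := fun x hx => (Finset.mem_filter.1 (hVW hx)).2
          intro i hi j hj hij
          rcases Finset.mem_insert.1 hi with rfl | hiV
          · rcases Finset.mem_insert.1 hj with rfl | hjV
            · exact absurd rfl hij
            · exact hcol j hjV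
          · rcases Finset.mem_insert.1 hj with rfl | hjV
            · rw [hsym]; exact hcol i hiV
            · exact hV i hiV j hjV hij
      · exact ⟨s, V, hsub, by rw [hVc, Function.update_of_ne hst], hV⟩

theorem no_mono_fin {N : ℕ} (hN : N ≤ 59) (t : Fin 3) (k : ℕ)
    (h : ¬ ∃ V : Finset (ZMod 59), V.card = k ∧
        ∀ i ∈ V, ∀ j ∈ V, i ≠ j → cyclicColor i j = t) :
    ¬ HasMonoCliqueOn N
      (fun i j => cyclicColor (Fin.castLE hN i : Fin 59) (Fin.castLE hN j : Fin 59)) t k := by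
  rintro ⟨V, hc, hV⟩
  refine h ⟨V.map (Fin.castLEEmb hN), by rw [← hc]; exact Finset.card_map _, ?_⟩
  intro i hi j hj hij
  obtain ⟨x, hx, rfl⟩ := Finset.mem_map.1 hi
  obtain ⟨y, hy, rfl⟩ := Finset.mem_map.1 hj
  exact hV x hx y hy (fun e => hij (by rw [e]))

/-- `R(3, 3, 6) ≥ 60`: the cyclic 3-coloring `cyclicColor` of the edges of `K_59`
contains no triangle in color `0`, no triangle in color `1`, and no `K_6` in color `2`. -/
theorem ramsey_3_3_6_ge_60 :
    60 ≤ ramseyNumber3 3 3 6 ∧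
    (¬ ∃ V : Finset (ZMod 59), V.card = 3 ∧
        ∀ i ∈ V, ∀ j ∈ V, i ≠ j → cyclicColor i j = 0) ∧
    (¬ ∃ V : Finset (ZMod 59), V.card = 3 ∧
        ∀ i ∈ V, ∀ j ∈ V, i ≠ j → cyclicColor i j = 1) ∧
    (¬ ∃ V : Finset (ZMod 59), V.card = 6 ∧
        ∀ i ∈ V, ∀ j ∈ V, i ≠ j → cyclicColor i j = 2) := by
  have h0 := no_mono 0 2 (by decide +kernel)
  have h1 := no_mono 1 2 (by decide +kernel)
  have h2 := no_mono 2 5 (by decide +kernel)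
  refine ⟨?_, h0, h1, h2⟩
  unfold ramseyNumber3
  refine le_csInf ?_ ?_
  · obtain ⟨N, hN⟩ := ramsey_exists _ ![3, 3, 6] rfl
    refine ⟨N, fun c hsym => ?_⟩
    obtain ⟨t, V, _, hc, hV⟩ := hN N c hsym Finset.univ (by simp)
    fin_cases t
    · exact Or.inl ⟨V, hc, hV⟩
    · exact Or.inr (Or.inl ⟨V, hc, hV⟩)
    · exact Or.inr (Or.inr ⟨V, hc, hV⟩)
  · intro N hN
    by_contra hlt
    have hle : N ≤ 59 := by omega
    rcases hN _ (fun i j => cyclicColor_symm (Fin.castLE hle i : Fin 59)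
      (Fin.castLE hle j : Fin 59)) with h | h | h
    · exact no_mono_fin hle 0 3 h0 h
    · exact no_mono_fin hle 1 3 h1 h
    · exact no_mono_fin hle 2 6 h2 h
end
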